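/- For every integer n ≥ 2 there exists a cake-division instance with n agents and 2 cakes, the first cut into n slices and the second cut into 2n−2 slices, in which the set of all n agents is not placatable. -/

import Mathlib

/-- The space of partitions of `d` cakes, cake `t` being cut into `a t` slices:
each coordinate lies in the standard simplex. -/
def PartitionSpace (d : ℕ) (a : Fin d → ℕ) : Set (∀ t, Fin (a t) → ℝ) :=
  {P | ∀ t, P t ∈ stdSimplex ℝ (Fin (a t))}

/-- A cake-division instance with `n` agents and `d` cakes, cake `t` cut into
`a t` slices: for each agent `i` and index vector `j`, a set `A i j ⊆ 𝒫` of
partitions in which agent `i` accepts the `d`-tuple of slices indexed by `j`.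
The sets are closed and the hungry-agents condition holds. -/
structure CakeInstance (n d : ℕ) (a : Fin d → ℕ) where
  A : Fin n → (∀ t, Fin (a t)) → Set (∀ t, Fin (a t) → ℝ)
  subset_partitionSpace : ∀ i j, A i j ⊆ PartitionSpace d a
  isClosed : ∀ i j, IsClosed (A i j)
  hungry : ∀ i, ∀ P ∈ PartitionSpace d a, ∃ j : ∀ t, Fin (a t),
    P ∈ A i j ∧ ∀ t, 0 < P t (j t)

/-- A set `Q` of agents is placatable: there exist a partition `P` and index
vectors, one acceptable at `P` for each agent of `Q`, such that the index
vectors of distinct agents of `Q` differ in every coordinate. -/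
def Placatable {n d : ℕ} {a : Fin d → ℕ} (C : CakeInstance n d a)
    (Q : Finset (Fin n)) : Prop :=
  ∃ P ∈ PartitionSpace d a, ∃ φ : Fin n → ∀ t, Fin (a t),
    (∀ q ∈ Q, P ∈ C.A q (φ q)) ∧
    ∀ q ∈ Q, ∀ q' ∈ Q, q ≠ q' → ∀ t, φ q t ≠ φ q' t

/-- Partitions of the second cake at which `n` agents with weighted-argmax preferences
can be given distinct slices. -/
def BadSet (n N : ℕ) (w : Fin N → ℝ) : Set (Fin N → ℝ) :=
  {y | y ∈ stdSimplex ℝ (Fin N) ∧ ∃ κ : Fin n → Fin N, Function.Injective κ ∧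
    ∀ i l, w l * y l ≤ w (κ i) * y (κ i)}

lemma badSet_closed (n N : ℕ) (w : Fin N → ℝ) : IsClosed (BadSet n N w) := by
  have h : BadSet n N w = stdSimplex ℝ (Fin N) ∩
      ⋃ κ ∈ {κ : Fin n → Fin N | Function.Injective κ},
        ⋂ i, ⋂ l, {y : Fin N → ℝ | w l * y l ≤ w (κ i) * y (κ i)} := by
    ext y
    simp [BadSet]
  rw [h]
  refine (isClosed_stdSimplex ℝ (Fin N)).inter ((Set.toFinite _).isClosed_biUnion fun κ _ => ?_)
  refine isClosed_iInter fun i => isClosed_iInter fun l => ?_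
  exact isClosed_le (by fun_prop) (by fun_prop)

lemma exists_pos_of_simplex {N : ℕ} {y : Fin N → ℝ} (hy : y ∈ stdSimplex ℝ (Fin N)) :
    ∃ l, 0 < y l := by
  by_contra! h
  have := Finset.sum_nonpos (s := Finset.univ) fun l _ => h l
  have := hy.2
  linarith

lemma badSet_disjoint (n N : ℕ) (hN : N + 2 ≤ 2 * n) :
    Disjoint (BadSet n N fun _ => 1) (BadSet n N fun l => (l : ℝ) + 1) := by
  rw [Set.disjoint_left]
  rintro y ⟨hy, κ, hκ, h⟩ ⟨-, κ', hκ', h'⟩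
  have hc : 1 < ((Finset.univ.image κ) ∩ (Finset.univ.image κ')).card := by
    have h1 := Finset.card_union_add_card_inter (Finset.univ.image κ) (Finset.univ.image κ')
    rw [Finset.card_image_of_injective _ hκ, Finset.card_image_of_injective _ hκ'] at h1
    have h2 := Finset.card_le_univ (Finset.univ.image κ ∪ Finset.univ.image κ')
    simp only [Finset.card_univ, Fintype.card_fin] at h1 h2
    omega
  obtain ⟨p, hp, q, hq, hpq⟩ := Finset.one_lt_card.1 hc
  simp only [Finset.mem_inter, Finset.mem_image, Finset.mem_univ, true_and] at hp hq
  obtain ⟨⟨i, rfl⟩, ⟨i', hi'⟩⟩ := hp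
  obtain ⟨⟨j, rfl⟩, ⟨j', hj'⟩⟩ := hq
  have e1 := h i (κ j)
  have e2 := h j (κ i)
  have e3 := h' i' (κ j)
  have e4 := h' j' (κ i)
  rw [hi'] at e3
  rw [hj'] at e4
  obtain ⟨l, hl⟩ := exists_pos_of_simplex hy
  have e5 := h i l
  have e6 : y (κ i) = y (κ j) := by linarith
  have e7 : ((κ i : ℕ) : ℝ) = (κ j : ℕ) := by
    have : 0 < y (κ j) := by linarith
    rw [e6] at e3 e4
    have := le_of_mul_le_mul_right e3 this
    have := le_of_mul_le_mul_right e4 ‹0 < y (κ j)›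
    linarith
  exact hpq (Fin.ext (by exact_mod_cast e7))

/-- Bonus of agent `i` for slice `j` of the first cake, depending on the second cake. -/
noncomputable def bonus (n N : ℕ) [NeZero n] (f : (Fin N → ℝ) → ℝ) (y : Fin N → ℝ)
    (i j : Fin n) : ℝ :=
  (if j = i then f y else if j = i + 1 then 1 - f y else 0) * (1 / (2 * n))

/-- Agent `i` accepts slices `j`, `k` at the partition `x`, `y`. -/
def Accepts (n N : ℕ) [NeZero n] (f : (Fin N → ℝ) → ℝ) (i : Fin n) (x : Fin n → ℝ) (y : Fin N → ℝ)
    (j : Fin n) (k : Fin N) : Prop :=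
  (∀ l, x l + bonus n N f y i l ≤ x j + bonus n N f y i j) ∧
    ((j = i ∧ ∀ l, (1 : ℝ) * y l ≤ 1 * y k) ∨
      (j ≠ i ∧ ∀ l : Fin N, ((l : ℝ) + 1) * y l ≤ ((k : ℝ) + 1) * y k))

lemma acc_closed (n N : ℕ) [NeZero n] (f : (Fin N → ℝ) → ℝ) (hf : Continuous f) (i j : Fin n)
    (k : Fin N) : IsClosed {p : (Fin n → ℝ) × (Fin N → ℝ) | Accepts n N f i p.1 p.2 j k} := by
  have hb : ∀ l, Continuous fun p : (Fin n → ℝ) × (Fin N → ℝ) => bonus n N f p.2 i l := by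
    intro l
    unfold bonus
    split_ifs <;> fun_prop
  unfold Accepts
  simp only [Set.ofPred_and, Set.ofPred_or, Set.ofPred_forall]
  refine IsClosed.inter ?_ (IsClosed.union (IsClosed.inter (by first | exact isClosed_const | exact isClosed_iInter fun _ => isClosed_const) ?_)
    (IsClosed.inter (by first | exact isClosed_const | exact isClosed_iInter fun _ => isClosed_const) ?_))
  · refine isClosed_iInter fun l => isClosed_le ?_ ?_
    · exact (by fun_prop : Continuous fun p : (Fin n → ℝ) × (Fin N → ℝ) => p.1 l).add (hb l)
    · exact (by fun_prop : Continuous fun p : (Fin n → ℝ) × (Fin N → ℝ) => p.1 j).add (hb j)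
  · exact isClosed_iInter fun l => isClosed_le (by fun_prop) (by fun_prop)
  · exact isClosed_iInter fun l => isClosed_le (by fun_prop) (by fun_prop)

lemma acc_hungry (n N : ℕ) [NeZero n] (f : (Fin N → ℝ) → ℝ)
    (hf : ∀ y, f y ∈ Set.Icc (0 : ℝ) 1) (i : Fin n) (x : Fin n → ℝ) (y : Fin N → ℝ)
    (hx : x ∈ stdSimplex ℝ (Fin n)) (hy : y ∈ stdSimplex ℝ (Fin N)) :
    ∃ j k, Accepts n N f i x y j k ∧ 0 < x j ∧ 0 < y k := by
  have hn : (0 : ℝ) < n := by exact_mod_cast Nat.pos_of_ne_zero (NeZero.ne n)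
  obtain ⟨j, hj⟩ := Finite.exists_max fun l => x l + bonus n N f y i l
  have hb0 : ∀ l, 0 ≤ bonus n N f y i l := by
    intro l
    have := hf y
    unfold bonus
    refine mul_nonneg ?_ (by positivity)
    split_ifs <;> linarith [this.1, this.2]
  have hb1 : ∀ l, bonus n N f y i l ≤ 1 / (2 * n) := by
    intro l
    have := hf y
    unfold bonus
    refine mul_le_of_le_one_left (by positivity) ?_
    split_ifs <;> linarith [this.1, this.2]
  have hxj : 0 < x j := by
    by_contra! h
    have h1 : ∀ l, x l ≤ 1 / (2 * n) := fun l => by linarith [hj l, hb0 l, hb1 j]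
    have h2 := Finset.sum_le_sum (s := Finset.univ) fun l _ => h1 l
    rw [hx.2] at h2
    simp only [Finset.sum_const, Finset.card_univ, Fintype.card_fin, nsmul_eq_mul] at h2
    have : (n : ℝ) * (1 / (2 * n)) = 1 / 2 := by field_simp
    linarith
  obtain ⟨l, hl⟩ := exists_pos_of_simplex hy
  have : Nonempty (Fin N) := ⟨l⟩
  by_cases hji : j = i
  · obtain ⟨k, hk⟩ := Finite.exists_max fun l => (1 : ℝ) * y l
    exact ⟨j, k, ⟨hj, Or.inl ⟨hji, hk⟩⟩, hxj, by linarith [hk l]⟩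
  · obtain ⟨k, hk⟩ := Finite.exists_max fun l : Fin N => ((l : ℝ) + 1) * y l
    refine ⟨j, k, ⟨hj, Or.inr ⟨hji, hk⟩⟩, hxj, ?_⟩
    have h1 : 0 < ((l : ℝ) + 1) * y l := by positivity
    have h2 : 0 < ((k : ℝ) + 1) * y k := lt_of_lt_of_le h1 (hk l)
    exact pos_of_mul_pos_right h2 (by positivity)

lemma rot_dichotomy (n : ℕ) [NeZero n] (π : Fin n → Fin n) (hπ : Function.Injective π)
    (h : ∀ i, π i = i ∨ π i = i + 1) : (∀ i, π i = i) ∨ ∀ i, π i ≠ i := by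
  by_contra! hc
  obtain ⟨⟨j, hj⟩, i, hi⟩ := hc
  have key : ∀ k : ℕ, π (i - Fin.ofNat n k) = i - Fin.ofNat n k := by
    intro k
    induction k with
    | zero => simpa using hi
    | succ k ih =>
      have e : i - Fin.ofNat n (k + 1) + 1 = i - Fin.ofNat n k := by
        have : Fin.ofNat n (k + 1) = Fin.ofNat n k + 1 := by
          apply Fin.ext; simp [Fin.val_add, Fin.ofNat]
        rw [this]; open Fin.CommRing in ring
      rcases h (i - Fin.ofNat n (k + 1)) with h1 | h1
      · exact h1
      · rw [e] at h1
        rw [h1]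
        exact (hπ (h1.trans ih.symm)).symm
  apply hj
  have := key (i - j).val
  simpa using this

lemma acc_not (n N : ℕ) [NeZero n] (hn : 2 ≤ n) (f : (Fin N → ℝ) → ℝ)
    (hf : ∀ y, f y ∈ Set.Icc (0 : ℝ) 1)
    (h0 : ∀ y ∈ BadSet n N fun _ => 1, f y = 0)
    (h1 : ∀ y ∈ BadSet n N fun l => (l : ℝ) + 1, f y = 1)
    (x : Fin n → ℝ) (y : Fin N → ℝ) (hy : y ∈ stdSimplex ℝ (Fin N))
    (π : Fin n → Fin n) (κ : Fin n → Fin N) (hπ : Function.Injective π)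
    (hκ : Function.Injective κ) (h : ∀ i, Accepts n N f i x y (π i) (κ i)) : False := by
  have hn0 : (0 : ℝ) < n := by exact_mod_cast Nat.pos_of_ne_zero (NeZero.ne n)
  have hε : (0 : ℝ) < 1 / (2 * n) := by positivity
  have hne : ∀ i : Fin n, i + 1 ≠ i := by
    intro i hi
    have : (1 : Fin n) = 0 := by simpa using hi
    have := congrArg Fin.val this
    rw [Fin.val_one', Fin.val_zero, Nat.mod_eq_of_lt (by omega)] at this
    omega
  obtain ⟨hf0, hf1⟩ := hf y
  have hsum : ∀ σ : Fin n → Fin n, Function.Injective σ →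
      ∑ i, bonus n N f y i (σ i) ≤ ∑ i, bonus n N f y i (π i) := by
    intro σ hσ
    have a1 := Finset.sum_le_sum (s := Finset.univ) fun i _ => (h i).1 (σ i)
    rw [Finset.sum_add_distrib, Finset.sum_add_distrib] at a1
    have a2 : ∑ i, x (σ i) = ∑ i, x i :=
      (Function.Injective.bijective_of_finite hσ).sum_comp x
    have a3 : ∑ i, x (π i) = ∑ i, x i :=
      (Function.Injective.bijective_of_finite hπ).sum_comp x
    linarith
  set M := max (f y) (1 - f y) * (1 / (2 * n)) with hM
  have hble : ∀ i j, bonus n N f y i j ≤ M := by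
    intro i j
    unfold bonus
    rw [hM]
    refine mul_le_mul_of_nonneg_right ?_ hε.le
    split_ifs
    · exact le_max_left _ _
    · exact le_max_right _ _
    · exact hf0.trans (le_max_left _ _)
  have hMs : ∑ _i : Fin n, M ≤ ∑ i, bonus n N f y i (π i) := by
    rcases le_total (f y) (1 - f y) with hl | hl
    · refine le_trans (le_of_eq ?_) (hsum (fun i => i + 1) (add_left_injective 1))
      refine Finset.sum_congr rfl fun i _ => ?_
      rw [hM, max_eq_right hl]
      simp [bonus, hne]
    · refine le_trans (le_of_eq ?_) (hsum id Function.injective_id)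
      refine Finset.sum_congr rfl fun i _ => ?_
      rw [hM, max_eq_left hl]
      simp [bonus]
  have heq : ∀ i, bonus n N f y i (π i) = M := by
    have e := le_antisymm (Finset.sum_le_sum fun i _ => hble i (π i)) hMs
    intro i
    exact (Finset.sum_eq_sum_iff_of_le fun i _ => hble i (π i)).1 e i (Finset.mem_univ i)
  have hval : ∀ i, (if π i = i then f y else if π i = i + 1 then 1 - f y else 0)
      = max (f y) (1 - f y) := fun i => mul_right_cancel₀ hε.ne' (heq i)
  have hpos : 0 < max (f y) (1 - f y) := by
    rcases lt_or_ge 0 (f y) with h | h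
    · exact lt_max_of_lt_left h
    · exact lt_max_of_lt_right (by linarith)
  have hd : ∀ i, π i = i ∨ π i = i + 1 := by
    intro i
    by_contra! hc
    have := hval i
    rw [if_neg hc.1, if_neg hc.2] at this
    linarith
  rcases rot_dichotomy n π hπ hd with hid | hrot
  · have hB : y ∈ BadSet n N fun _ => 1 := by
      refine ⟨hy, κ, hκ, fun i l => ?_⟩
      rcases (h i).2 with h | h
      · exact h.2 l
      · exact absurd (hid i) h.1
    have := hval 0
    rw [if_pos (hid 0)] at this
    rw [h0 y hB] at this hpos
    linarith
  · have hB : y ∈ BadSet n N fun l => (l : ℝ) + 1 := by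
      refine ⟨hy, κ, hκ, fun i l => ?_⟩
      rcases (h i).2 with h | h
      · exact absurd h.1 (hrot i)
      · exact h.2 l
    have := hval 0
    rw [if_neg (hrot 0), if_pos ((hd 0).resolve_left (hrot 0))] at this
    rw [h1 y hB] at this hpos
    linarith

/-- For `n ≥ 2` there is a cake-division instance with `n` agents and `2` cakes,
the first cut into `n` slices and the second into `2n-2` slices, in which the
set of all `n` agents is not placatable. -/
theorem ad_upper_n_n_2n2 (n : ℕ) (hn : 2 ≤ n) :
    ∃ C : CakeInstance n 2 ![n, 2 * n - 2],
      ¬ Placatable C (Finset.univ : Finset (Fin n)) := by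
  have : NeZero n := ⟨by omega⟩
  obtain ⟨f, hf0, hf1, hf⟩ := exists_continuous_zero_one_of_isClosed
    (badSet_closed n (2 * n - 2) fun _ => 1) (badSet_closed n (2 * n - 2) fun l => (l : ℝ) + 1)
    (badSet_disjoint n (2 * n - 2) (by omega))
  refine ⟨⟨fun i j => {P | P ∈ PartitionSpace 2 ![n, 2 * n - 2] ∧
    Accepts n (2 * n - 2) f i (P 0) (P 1) (j 0) (j 1)}, fun i j P hP => hP.1, ?_, ?_⟩, ?_⟩
  · intro i j
    refine IsClosed.inter ?_ ?_
    · have : PartitionSpace 2 ![n, 2 * n - 2] = ⋂ t, (fun P => P t) ⁻¹' stdSimplex ℝ _ := by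
        ext P; simp [PartitionSpace]
      change IsClosed (PartitionSpace 2 ![n, 2 * n - 2])
      rw [this]
      exact isClosed_iInter fun t => (isClosed_stdSimplex ℝ _).preimage (continuous_apply t)
    · have hc : Continuous (fun P : ∀ t, Fin ((![n, 2 * n - 2] : Fin 2 → ℕ) t) → ℝ =>
          ((P 0, P 1) : (Fin n → ℝ) × (Fin (2 * n - 2) → ℝ))) :=
        Continuous.prodMk (continuous_apply (0 : Fin 2)) (continuous_apply (1 : Fin 2))
      exact IsClosed.preimage hc (acc_closed n (2 * n - 2) f f.continuous i (j 0) (j 1))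
  · intro i P hP
    obtain ⟨j, k, ha, hj, hk⟩ := acc_hungry n (2 * n - 2) f hf i (P 0) (P 1) (hP 0) (hP 1)
    refine ⟨Fin.cons j (Fin.cons k finZeroElim), ⟨hP, ha⟩, ?_⟩
    intro t
    fin_cases t
    · exact hj
    · exact hk
  · rintro ⟨P, hP, φ, hφ, hd⟩
    refine acc_not n (2 * n - 2) hn f hf (fun y hy => hf0 hy) (fun y hy => hf1 hy) (P 0) (P 1)
      (hP 1) (fun i => φ i 0) (fun i => φ i 1) ?_ ?_
      (fun i => (hφ i (Finset.mem_univ i)).2)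
    · intro a b hab
      by_contra hne
      exact hd a (Finset.mem_univ _) b (Finset.mem_univ _) hne 0 hab
    · intro a b hab
      by_contra hne
      exact hd a (Finset.mem_univ _) b (Finset.mem_univ _) hne 1 hab
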